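/- arXiv:2409.06094 — 2 statements merged into one kernel-verified Lean document; each statement's English description precedes it below -/
import Mathlib

section
/- Let E be a complex inner product space, let f : E → ℂ be complex-differentiable everywhere, write u = Re f and v = Im f, and let I ⊆ ℝ be an interval containing 0. Suppose c : I → E is differentiable with ∇u(c(t)) ≠ 0 and c'(t) = ‖∇u(c(t))‖⁻² • ∇u(c(t)) for all t ∈ I. Then (u∘c)'(t) = 1 and (v∘c)'(t) = 0 for all t ∈ I; consequently f(c(t)) = f(c(0)) + t for all t ∈ I, so if c(0) ∈ f⁻¹(0) then c(t) ∈ f⁻¹(t). -/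
/- Regard a complex inner product space as a real inner product space via
`⟨a,b⟩_ℝ = Re ⟨a,b⟩`. -/
attribute [local instance] InnerProductSpace.complexToReal

/-- A complex-differentiable function has complex derivative `‖g‖²` in the direction of the
gradient `g` of its real part: by the Cauchy–Riemann equations its imaginary part is stationary. -/
theorem fderiv_apply_gradient_re {E : Type*} [NormedAddCommGroup E] [InnerProductSpace ℂ E]
    [CompleteSpace E] {f : E → ℂ} {x : E} (hf : DifferentiableAt ℂ f x) :
    fderiv ℂ f x (gradient (fun y => (f y).re) x) =
      ((‖gradient (fun y => (f y).re) x‖ ^ 2 : ℝ) : ℂ) := by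
  have hu : HasFDerivAt (fun y => (f y).re)
      (Complex.reCLM.comp ((fderiv ℂ f x).restrictScalars ℝ)) x :=
    Complex.reCLM.hasFDerivAt.comp x (hf.hasFDerivAt.restrictScalars ℝ)
  set g := gradient (fun y => (f y).re) x
  have hg (h : E) : (fderiv ℂ f x h).re = (inner ℂ g h).re := by
    have := hu.differentiableAt.hasGradientAt.hasFDerivAt.unique hu
    exact (DFunLike.congr_fun this h).symm
  apply Complex.ext
  · rw [hg, inner_self_eq_norm_sq_to_K]
    norm_cast
  · have := hg (Complex.I • g)
    rw [map_smul, inner_smul_right, inner_self_eq_norm_sq_to_K] at this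
    simpa [← Complex.ofReal_pow] using this

/-- On an interval, a function with constant derivative is affine. -/
theorem Set.OrdConnected.eq_add_smul_of_hasDerivWithinAt {F : Type*} [NormedAddCommGroup F]
    [NormedSpace ℝ F] {I : Set ℝ} (hI : I.OrdConnected) {φ : ℝ → F} {a : F}
    (hφ : ∀ t ∈ I, HasDerivWithinAt φ a I t) {s t : ℝ} (hs : s ∈ I) (ht : t ∈ I) :
    φ t = φ s + (t - s) • a := by
  have hψ (r : ℝ) (hr : r ∈ I) : HasDerivWithinAt (fun r => φ r - r • a) 0 I r := by
    exact ((hφ r hr).sub ((hasDerivWithinAt_id r I).smul_const a)).congr_deriv (by simp)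
  have h := hI.convex.norm_image_sub_le_of_norm_hasDerivWithin_le (C := 0) hψ (by simp) hs ht
  rw [zero_mul, norm_le_zero_iff, sub_eq_zero, sub_eq_iff_eq_add] at h
  rw [h, sub_smul]
  abel

/-- Let `E` be a complex inner product space, `f : E → ℂ`
complex-differentiable everywhere, `u = Re f`, `v = Im f`, and let `I ⊆ ℝ` be an interval
containing `0`.  If `c : I → E` is differentiable with `∇u(c t) ≠ 0` and
`c'(t) = ‖∇u(c t)‖⁻² • ∇u(c t)` for all `t ∈ I`, then `(u ∘ c)' = 1` and `(v ∘ c)' = 0` on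
`I`; consequently `f (c t) = f (c 0) + t` for all `t ∈ I`, so if `c 0 ∈ f⁻¹(0)` then
`c t ∈ f⁻¹(t)`. -/
theorem integral_curve_of_normalized_gradient_re
    {E : Type*} [NormedAddCommGroup E] [InnerProductSpace ℂ E] [CompleteSpace E]
    (f : E → ℂ) (hf : Differentiable ℂ f)
    (I : Set ℝ) (hI : I.OrdConnected) (h0 : (0 : ℝ) ∈ I)
    (c : ℝ → E)
    (hgrad : ∀ t ∈ I, gradient (fun x => (f x).re) (c t) ≠ 0)
    (hc : ∀ t ∈ I, HasDerivWithinAt c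
      ((‖gradient (fun x => (f x).re) (c t)‖ ^ 2)⁻¹ • gradient (fun x => (f x).re) (c t))
      I t) :
    (∀ t ∈ I, HasDerivWithinAt (fun s => (f (c s)).re) 1 I t) ∧
    (∀ t ∈ I, HasDerivWithinAt (fun s => (f (c s)).im) 0 I t) ∧
    (∀ t ∈ I, f (c t) = f (c 0) + t) ∧
    (f (c 0) = 0 → ∀ t ∈ I, f (c t) = t) := by
  have hfc (t : ℝ) (ht : t ∈ I) : HasDerivWithinAt (fun s => f (c s)) 1 I t := by
    have h := ((hf (c t)).hasFDerivAt.restrictScalars ℝ).comp_hasDerivWithinAt t (hc t ht)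
    refine h.congr_deriv ?_
    have hg : ‖gradient (fun x => (f x).re) (c t)‖ ^ 2 ≠ 0 :=
      pow_ne_zero 2 (norm_ne_zero_iff.mpr (hgrad t ht))
    rw [map_smul, ContinuousLinearMap.coe_restrictScalars', fderiv_apply_gradient_re (hf (c t)),
      Complex.real_smul, ← Complex.ofReal_mul, inv_mul_cancel₀ hg, Complex.ofReal_one]
  have hline (t : ℝ) (ht : t ∈ I) : f (c t) = f (c 0) + t := by
    simpa using hI.eq_add_smul_of_hasDerivWithinAt hfc h0 ht
  refine ⟨fun t ht => ?_, fun t ht => ?_, hline, fun h t ht => by rw [hline t ht, h, zero_add]⟩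
  · exact (Complex.reCLM.hasFDerivAt.comp_hasDerivWithinAt t (hfc t ht)).congr_deriv (by simp)
  · exact (Complex.imCLM.hasFDerivAt.comp_hasDerivWithinAt t (hfc t ht)).congr_deriv (by simp)
end

section
/- Let n ≥ 2 be an integer and let ε ∈ (0,1). For every continuously differentiable function φ : [ε,1] → ℝ with φ(ε) = φ(1) = 0, one has ∫_ε^1 φ'(r)² r^{n-1} dr ≥ ((n-2)²/4 + (π/log ε)²) ∫_ε^1 φ(r)² r^{n-3} dr. -/
/-- The weighted Poincaré inequality on `[ε, 1]` with a frequency `c` strictly below the critical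
value `π / |log ε|`, proved by Picone's identity with the positive supersolution
`r ^ (-a / 2) * cos (c * (log r - log ε / 2))`. -/
theorem weighted_poincare_of_mul_log_lt_pi (a ε c : ℝ) (hε : ε ∈ Set.Ioo (0 : ℝ) 1)
    (hc : 0 ≤ c) (hcε : c * -Real.log ε < Real.pi) (φ φ' : ℝ → ℝ)
    (hφ : ∀ r ∈ Set.Icc ε 1, HasDerivWithinAt φ (φ' r) (Set.Icc ε 1) r)
    (hφ' : ContinuousOn φ' (Set.Icc ε 1))
    (hbε : φ ε = 0) (hb1 : φ 1 = 0) :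
    (a ^ 2 / 4 + c ^ 2) * ∫ r in ε..1, φ r ^ 2 * r ^ (a - 1) ≤
      ∫ r in ε..1, φ' r ^ 2 * r ^ (a + 1) := by
  obtain ⟨hε0, hε1⟩ := hε
  have hφc : ContinuousOn φ (Set.Icc ε 1) := fun r hr => (hφ r hr).continuousWithinAt
  have hpos : ∀ r ∈ Set.Icc ε 1, 0 < r := fun r hr => hε0.trans_le hr.1
  have hpow : ∀ b : ℝ, ContinuousOn (fun r : ℝ => r ^ b) (Set.Icc ε 1) := fun b =>
    continuousOn_id.rpow_const fun r hr => Or.inl (hpos r hr).ne'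
  have hcos : ∀ r ∈ Set.Icc ε 1, 0 < Real.cos (c * (Real.log r - Real.log ε / 2)) := by
    intro r hr
    have h1 : Real.log ε ≤ Real.log r := Real.log_le_log hε0 hr.1
    have h2 : Real.log r ≤ 0 := Real.log_nonpos (hpos r hr).le hr.2
    apply Real.cos_pos_of_mem_Ioo
    constructor <;> nlinarith
  have hderiv : ∀ r ∈ Set.Icc ε 1, HasDerivWithinAt
      (fun r => (-a / 2 - c * Real.tan (c * (Real.log r - Real.log ε / 2))) * r ^ a * φ r ^ 2)
      ((-(c * (1 / Real.cos (c * (Real.log r - Real.log ε / 2)) ^ 2 * (c * r⁻¹))) * r ^ a +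
        (-a / 2 - c * Real.tan (c * (Real.log r - Real.log ε / 2))) * (a * r ^ (a - 1))) *
          φ r ^ 2 +
        (-a / 2 - c * Real.tan (c * (Real.log r - Real.log ε / 2))) * r ^ a *
          (2 * φ r * φ' r)) (Set.Icc ε 1) r := by
    intro r hr
    have hr0 := (hpos r hr).ne'
    have htan := (Real.hasDerivAt_tan (hcos r hr).ne').comp r
      (((Real.hasDerivAt_log hr0).sub_const (Real.log ε / 2)).const_mul c)
    have h := ((((htan.const_mul c).const_sub (-a / 2)).mul
      (Real.hasDerivAt_rpow_const (p := a) (Or.inl hr0))).hasDerivWithinAt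
        (s := Set.Icc ε 1)).mul ((hφ r hr).pow 2)
    refine h.congr_deriv ?_
    simp
  have hintegrable : ∀ f : ℝ → ℝ, ContinuousOn f (Set.Icc ε 1) →
      IntervalIntegrable f MeasureTheory.volume ε 1 := fun f hf =>
    ContinuousOn.intervalIntegrable_of_Icc hε1.le hf
  have hc1 : ContinuousOn (fun r => φ' r ^ 2 * r ^ (a + 1)) (Set.Icc ε 1) :=
    (hφ'.pow 2).mul (hpow (a + 1))
  have hc2 : ContinuousOn (fun r => (a ^ 2 / 4 + c ^ 2) * (φ r ^ 2 * r ^ (a - 1)))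
      (Set.Icc ε 1) := ((hφc.pow 2).mul (hpow (a - 1))).const_mul _
  have key := intervalIntegral.sub_le_integral_of_hasDeriv_right_of_le hε1.le
    (fun r hr => (hderiv r hr).continuousWithinAt)
    (fun r hr => ((hderiv r (Set.Ioo_subset_Icc_self hr)).hasDerivAt
      (Icc_mem_nhds hr.1 hr.2)).hasDerivWithinAt)
    (φ := fun r => φ' r ^ 2 * r ^ (a + 1) - (a ^ 2 / 4 + c ^ 2) * (φ r ^ 2 * r ^ (a - 1)))
    ((hc1.sub hc2).integrableOn_Icc) (by
      intro r hr
      have hr' := Set.Ioo_subset_Icc_self hr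
      have hr0 := hpos r hr'
      have hsec : 1 / Real.cos (c * (Real.log r - Real.log ε / 2)) ^ 2 =
          1 + Real.tan (c * (Real.log r - Real.log ε / 2)) ^ 2 := by
        rw [one_div, ← Real.inv_one_add_tan_sq (hcos r hr').ne', inv_inv]
      have ha : r ^ a = r ^ (a - 1) * r := by
        rw [← Real.rpow_add_one hr0.ne', sub_add_cancel]
      rw [hsec, Real.rpow_add_one hr0.ne', ha, ← sub_nonneg]
      generalize Real.tan (c * (Real.log r - Real.log ε / 2)) = t
      have hsq : 0 ≤ (φ' r * r - (-a / 2 - c * t) * φ r) ^ 2 * r ^ (a - 1) :=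
        mul_nonneg (sq_nonneg _) (Real.rpow_nonneg hr0.le _)
      refine hsq.trans_eq ?_
      field_simp
      ring)
  rw [intervalIntegral.integral_sub (hintegrable _ hc1) (hintegrable _ hc2),
    intervalIntegral.integral_const_mul] at key
  simp only [hbε, hb1] at key
  linarith

/-- Let `n ≥ 2` be an integer and `ε ∈ (0,1)`.  For every continuously
differentiable `φ : [ε,1] → ℝ` (with derivative `φ'` on `[ε,1]`) satisfying
`φ(ε) = φ(1) = 0`, one has the sharp weighted Poincaré inequality
`∫_ε^1 φ'(r)² r^(n-1) dr ≥ ((n-2)²/4 + (π/log ε)²) ∫_ε^1 φ(r)² r^(n-3) dr`. -/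
theorem weighted_poincare_inequality_truncated_cone
    (n : ℕ) (hn : 2 ≤ n) (ε : ℝ) (hε : ε ∈ Set.Ioo (0 : ℝ) 1)
    (φ φ' : ℝ → ℝ)
    (hφ : ∀ r ∈ Set.Icc ε 1, HasDerivWithinAt φ (φ' r) (Set.Icc ε 1) r)
    (hφ' : ContinuousOn φ' (Set.Icc ε 1))
    (hbε : φ ε = 0) (hb1 : φ 1 = 0) :
    ∫ r in ε..1, φ' r ^ 2 * r ^ ((n : ℝ) - 1) ≥
      (((n : ℝ) - 2) ^ 2 / 4 + (Real.pi / Real.log ε) ^ 2) *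
        ∫ r in ε..1, φ r ^ 2 * r ^ ((n : ℝ) - 3) := by
  have hlog : Real.log ε < 0 := Real.log_neg hε.1 hε.2
  have hk : 0 < Real.pi / -Real.log ε := div_pos Real.pi_pos (neg_pos.2 hlog)
  rw [ge_iff_le, show (Real.pi / Real.log ε) ^ 2 = (Real.pi / -Real.log ε) ^ 2 by
    rw [div_neg, neg_sq]]
  have hlim : Filter.Tendsto
      (fun c : ℝ => (((n : ℝ) - 2) ^ 2 / 4 + c ^ 2) *
        ∫ r in ε..1, φ r ^ 2 * r ^ ((n : ℝ) - 3))
      (nhdsWithin (Real.pi / -Real.log ε) (Set.Iio (Real.pi / -Real.log ε)))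
      (nhds ((((n : ℝ) - 2) ^ 2 / 4 + (Real.pi / -Real.log ε) ^ 2) *
        ∫ r in ε..1, φ r ^ 2 * r ^ ((n : ℝ) - 3))) :=
    (Continuous.tendsto (by fun_prop) _).mono_left nhdsWithin_le_nhds
  refine le_of_tendsto hlim ?_
  filter_upwards [Ioo_mem_nhdsLT hk] with c hc
  have h := weighted_poincare_of_mul_log_lt_pi ((n : ℝ) - 2) ε c hε hc.1.le
    ((lt_div_iff₀ (neg_pos.2 hlog)).1 hc.2) φ φ' hφ hφ' hbε hb1
  rwa [show (n : ℝ) - 2 - 1 = n - 3 by ring, show (n : ℝ) - 2 + 1 = n - 1 by ring] at h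
end
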